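/- arXiv:2403.03301 — 2 statements merged into one kernel-verified Lean document; each statement's English description precedes it below -/
import Mathlib

section
/- Let p > 3 be a prime with p \equiv 1, 3, 7, or 9 mod 20. Then \sum_{k=0}^{p-1} (1 + \frac{20}{3} k) \frac{(4k)!}{k!^4} (-1/1024)^k \equiv (-1)^{(p-1)/2} p mod p^3 in Z_p. -/
open Finset

/-- The hypergeometric term of the Guillera–Zudilin WZ pair. -/
noncomputable def wzTerm (K : Type*) [Field K] (n k : ℕ) : K :=
  (-1) ^ (n + k) * 4 ^ k * (k.factorial : K) ^ 2 * (4 * n + 2 * k).factorial *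
    (2 * n).factorial * n.descFactorial k /
    (1024 ^ n * (2 * n + k).factorial * (n.factorial : K) ^ 4 * ((2 * k).factorial : K) ^ 2)

section WZ

variable {K : Type*} [Field K] [CharZero K]

theorem wzTerm_succ_right (n k : ℕ) :
    (2 * k + 1 : K) ^ 2 * wzTerm K n (k + 1) =
      -(2 * (4 * n + 2 * k + 1) * (n - k)) * wzTerm K n k := by
  have h1 : ((2 * n + k).factorial : K) ≠ 0 := by exact_mod_cast Nat.factorial_ne_zero _
  have h2 : (n.factorial : K) ≠ 0 := by exact_mod_cast Nat.factorial_ne_zero _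
  have h3 : ((2 * k).factorial : K) ≠ 0 := by exact_mod_cast Nat.factorial_ne_zero _
  have h4 : (2 * n + k + 1 : K) ≠ 0 := by exact_mod_cast Nat.succ_ne_zero (2 * n + k)
  have h5 : (2 * k + 1 : K) ≠ 0 := by exact_mod_cast Nat.succ_ne_zero (2 * k)
  have h6 : (k + 1 : K) ≠ 0 := by exact_mod_cast Nat.succ_ne_zero (k)
  have hd : (n.descFactorial (k + 1) : K) = (n - k) * n.descFactorial k := by
    rw [Nat.descFactorial_succ]
    rcases le_or_gt k n with h | h
    · push_cast [Nat.cast_sub h]; ring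
    · simp [Nat.descFactorial_of_lt h]
  unfold wzTerm
  rw [hd, show 4 * n + 2 * (k + 1) = 4 * n + 2 * k + 1 + 1 by ring,
    show 2 * n + (k + 1) = 2 * n + k + 1 by ring, show 2 * (k + 1) = 2 * k + 1 + 1 by ring]
  simp only [Nat.factorial_succ]
  push_cast
  rw [show (2 * k + 1 + 1 : K) = 2 * (k + 1) by ring,
    show (4 * n + 2 * k + 1 + 1 : K) = 2 * (2 * n + k + 1) by ring]
  field_simp
  ring

theorem wzTerm_succ_succ (n k : ℕ) :
    64 * (n + 1 : K) ^ 2 * (2 * k + 1) ^ 2 * wzTerm K (n + 1) (k + 1) =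
      (4 * n + 2 * k + 1) * (4 * n + 2 * k + 3) * (4 * n + 2 * k + 5) * (2 * n + 1) *
        wzTerm K n k := by
  have h1 : ((2 * n + k).factorial : K) ≠ 0 := by exact_mod_cast Nat.factorial_ne_zero _
  have h2 : (n.factorial : K) ≠ 0 := by exact_mod_cast Nat.factorial_ne_zero _
  have h3 : ((2 * k).factorial : K) ≠ 0 := by exact_mod_cast Nat.factorial_ne_zero _
  have h4 : (2 * n + k + 1 : K) ≠ 0 := by exact_mod_cast Nat.succ_ne_zero (2 * n + k)
  have h5 : (2 * k + 1 : K) ≠ 0 := by exact_mod_cast Nat.succ_ne_zero (2 * k)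
  have h6 : (k + 1 : K) ≠ 0 := by exact_mod_cast Nat.succ_ne_zero (k)
  have h7 : (2 * n + k + 2 : K) ≠ 0 := by exact_mod_cast Nat.succ_ne_zero (2 * n + k + 1)
  have h8 : (2 * n + k + 3 : K) ≠ 0 := by exact_mod_cast Nat.succ_ne_zero (2 * n + k + 2)
  have h9 : (n + 1 : K) ≠ 0 := by exact_mod_cast Nat.succ_ne_zero (n)
  unfold wzTerm
  rw [show 4 * (n + 1) + 2 * (k + 1) = 4 * n + 2 * k + 1 + 1 + 1 + 1 + 1 + 1 by ring,
    show 2 * (n + 1) + (k + 1) = 2 * n + k + 1 + 1 + 1 by ring,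
    show 2 * (k + 1) = 2 * k + 1 + 1 by ring, show 2 * (n + 1) = 2 * n + 1 + 1 by ring]
  simp only [Nat.factorial_succ, Nat.succ_descFactorial_succ]
  push_cast
  rw [show (2 * k + 1 + 1 : K) = 2 * (k + 1) by ring,
    show (2 * n + 1 + 1 : K) = 2 * (n + 1) by ring,
    show (2 * n + k + 2 + 1 : K) = 2 * n + k + 3 by ring,
    show (2 * n + k + 1 + 1 : K) = 2 * n + k + 2 by ring,
    show (4 * n + 2 * k + 5 + 1 : K) = 2 * (2 * n + k + 3) by ring,
    show (4 * n + 2 * k + 3 + 1 : K) = 2 * (2 * n + k + 2) by ring,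
    show (4 * n + 2 * k + 1 + 1 : K) = 2 * (2 * n + k + 1) by ring]
  rw [mul_div_assoc', mul_div_assoc', div_eq_div_iff (by simp [*]) (by simp [*])]
  ring

theorem wzTerm_telescope (n k : ℕ) :
    (20 * n - 2 * k + 3 : K) * wzTerm K n k - (20 * n - 2 * (k + 1 : ℕ) + 3) * wzTerm K n (k + 1) =
      64 * ((n + 1 : ℕ) : K) ^ 2 * wzTerm K (n + 1) (k + 1) / (4 * (n + 1 : ℕ) + 2 * k + 1) -
        64 * (n : K) ^ 2 * wzTerm K n (k + 1) / (4 * n + 2 * k + 1) := by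
  have h5 : (2 * k + 1 : K) ≠ 0 := by exact_mod_cast Nat.succ_ne_zero (2 * k)
  have h6 : (4 * n + 2 * k + 1 : K) ≠ 0 := by exact_mod_cast Nat.succ_ne_zero (4 * n + 2 * k)
  have h7 : (4 * n + 2 * k + 5 : K) ≠ 0 := by exact_mod_cast Nat.succ_ne_zero (4 * n + 2 * k + 4)
  have hr := wzTerm_succ_right (K := K) n k
  have hs := wzTerm_succ_succ (K := K) n k
  have e₁ : 64 * (n + 1 : K) ^ 2 * wzTerm K (n + 1) (k + 1) / (4 * n + 2 * k + 5) =
      (4 * n + 2 * k + 1) * (4 * n + 2 * k + 3) * (2 * n + 1) * wzTerm K n k /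
        (2 * k + 1) ^ 2 := by
    rw [div_eq_div_iff h7 (pow_ne_zero 2 h5)]
    linear_combination hs
  have e₂ : 64 * (n : K) ^ 2 * wzTerm K n (k + 1) / (4 * n + 2 * k + 1) =
      -(128 * n ^ 2 * (n - k)) * wzTerm K n k / (2 * k + 1) ^ 2 := by
    rw [div_eq_div_iff h6 (pow_ne_zero 2 h5)]
    linear_combination 64 * (n : K) ^ 2 * hr
  have e₃ : wzTerm K n (k + 1) = -(2 * (4 * n + 2 * k + 1) * (n - k)) * wzTerm K n k /
      (2 * k + 1) ^ 2 := by
    rw [eq_div_iff (pow_ne_zero 2 h5), ← hr, mul_comm]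
  push_cast
  rw [show (4 * (n + 1) + 2 * k + 1 : K) = 4 * n + 2 * k + 5 by ring, e₁, e₂, e₃]
  field_simp
  ring

theorem sum_wzTerm_zero (N m : ℕ) :
    ∑ n ∈ range N, (20 * n + 3) * wzTerm K n 0 =
      ∑ n ∈ range N, (20 * n - 2 * m + 3) * wzTerm K n m +
        ∑ k ∈ range m, 64 * (N : K) ^ 2 * wzTerm K N (k + 1) / (4 * N + 2 * k + 1) := by
  induction m with
  | zero => simp
  | succ k ih =>
    have h := sum_range_sub
      (fun n : ℕ ↦ 64 * (n : K) ^ 2 * wzTerm K n (k + 1) / (4 * n + 2 * k + 1)) N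
    simp only [← wzTerm_telescope, sum_sub_distrib] at h
    rw [ih, sum_range_succ _ k]
    simp only [Nat.cast_zero, zero_pow two_ne_zero, mul_zero, zero_mul, zero_div, sub_zero] at h
    linear_combination h

end WZ
/-- A product `∏ (x + d i)` is congruent modulo `x ^ 2` to an affine function of `x`, whose
linear coefficient depends on `d` only through a power of `d`. -/
theorem exists_sq_dvd_prod_add (n : ℕ) : ∃ b : ℤ, ∀ x d : ℤ,
    x ^ 2 ∣ d * ∏ i ∈ range n, (x + d * (i + 1)) - d ^ n * (d * n.factorial + b * x) := by
  induction n with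
  | zero => exact ⟨0, fun x d ↦ by simp⟩
  | succ n ih =>
    obtain ⟨b, hb⟩ := ih
    refine ⟨n.factorial + (n + 1) * b, fun x d ↦ ?_⟩
    obtain ⟨c, hc⟩ := hb x d
    refine ⟨c * (x + d * (n + 1)) + d ^ n * b, ?_⟩
    rw [prod_range_succ, Nat.factorial_succ]
    push_cast
    linear_combination (x + d * (n + 1)) * hc

theorem prod_odd_mul (m : ℕ) :
    2 ^ m * m.factorial * ∏ i ∈ range m, (2 * i + 1) = (2 * m).factorial := by
  induction m with
  | zero => simp
  | succ m ih =>
    rw [prod_range_succ, Nat.factorial_succ, show 2 * (m + 1) = 2 * m + 1 + 1 by ring,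
      Nat.factorial_succ, Nat.factorial_succ, ← ih]
    ring

theorem prod_range_neg_one_mul (n : ℕ) (f : ℕ → ℤ) :
    ∏ i ∈ range n, -1 * f i = (-1) ^ n * ∏ i ∈ range n, f i := by
  rw [prod_mul_distrib, prod_const, card_range]

theorem prod_neg_add_eq (m : ℕ) :
    ∏ i ∈ range m, (-(2 * m + 1 : ℤ) + (i + 1)) =
      (-1) ^ m * ∏ i ∈ range m, ((m + 1 + i : ℕ) : ℤ) := by
  rw [← prod_range_reflect, ← prod_range_neg_one_mul]
  refine prod_congr rfl fun i hi ↦ ?_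
  have := mem_range.mp hi
  push_cast [show m - 1 - i = m - (i + 1) by omega, Nat.cast_sub (show i + 1 ≤ m by omega)]
  ring

theorem factorial_two_mul_eq (m : ℕ) :
    ((2 * m).factorial : ℤ) =
      (-1) ^ m * m.factorial * ∏ i ∈ range m, (-(2 * m + 1 : ℤ) + (i + 1)) := by
  rw [prod_neg_add_eq, two_mul, ← Nat.factorial_mul_ascFactorial, Nat.ascFactorial_eq_prod_range]
  push_cast
  have : (-1 : ℤ) ^ m * (-1) ^ m = 1 := by rw [← mul_pow]; norm_num
  linear_combination -(m.factorial * ∏ i ∈ range m, (m + 1 + i : ℤ)) * this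

theorem two_pow_mul_prod_eq (m : ℕ) :
    (2 : ℤ) ^ m * ∏ i ∈ range m, (-(2 * m + 1 : ℤ) + 2 * (i + 1)) =
      ∏ i ∈ range m, (-(2 * m + 1 : ℤ) + (i + 1)) := by
  have h₁ : ∏ i ∈ range m, (-(2 * m + 1 : ℤ) + 2 * (i + 1)) =
      (-1) ^ m * ∏ i ∈ range m, ((2 * i + 1 : ℕ) : ℤ) := by
    rw [← prod_range_reflect, ← prod_range_neg_one_mul]
    refine prod_congr rfl fun i hi ↦ ?_
    have := mem_range.mp hi
    push_cast [show m - 1 - i = m - (i + 1) by omega, Nat.cast_sub (show i + 1 ≤ m by omega)]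
    ring
  have h₃ : 2 ^ m * m.factorial * ∏ i ∈ range m, (2 * i + 1) =
      m.factorial * ∏ i ∈ range m, (m + 1 + i) := by
    rw [prod_odd_mul, ← Nat.ascFactorial_eq_prod_range, Nat.factorial_mul_ascFactorial, two_mul]
  have h₄ : 2 ^ m * ∏ i ∈ range m, (2 * i + 1) = ∏ i ∈ range m, (m + 1 + i) :=
    Nat.eq_of_mul_eq_mul_left m.factorial_pos (by rw [← h₃]; ring)
  rw [h₁, prod_neg_add_eq, ← Nat.cast_prod, ← Nat.cast_prod, ← h₄]
  push_cast
  ring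

section Congruences

variable {p : ℕ} (hp : p.Prime)
include hp

theorem prime_dvd_four_pow_sub_one {m : ℕ} (hm : p = 2 * m + 1) : (p : ℤ) ∣ 4 ^ m - 1 := by
  have h : IsCoprime (2 : ℤ) p := by
    rw [hm]; exact ⟨-m, 1, by push_cast; ring⟩
  have := (Int.ModEq.pow_card_sub_one_eq_one hp h).symm.dvd
  rwa [hm, Nat.add_sub_cancel, pow_mul, ← hm] at this

/-- The weak form of Morley's congruence, written as a ratio of products. -/
theorem sq_dvd_prod_sub_prod {m : ℕ} (hm : p = 2 * m + 1) :
    (p : ℤ) ^ 2 ∣ ∏ i ∈ range m, (-(p : ℤ) + (i + 1)) -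
      256 ^ m * ∏ i ∈ range m, ((p : ℤ) + (i + 1)) := by
  obtain ⟨b, hb⟩ := exists_sq_dvd_prod_add m
  obtain ⟨v, hv⟩ := prime_dvd_four_pow_sub_one hp hm
  have h₀ := two_pow_mul_prod_eq m
  obtain ⟨c₁, h₁⟩ := hb (-p) 1
  obtain ⟨c₂, h₂⟩ := hb p 1
  obtain ⟨c₃, h₃⟩ := hb (-p) 2
  rw [show (2 * m + 1 : ℤ) = p by rw [hm]; push_cast; ring] at h₀
  simp only [one_mul, one_pow] at h₁ h₂
  have hu : (4 : ℤ) ^ m = 1 + p * v := by linear_combination hv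
  have hu' : (2 : ℤ) ^ m * 2 ^ m = 1 + p * v := by rw [← hu, ← mul_pow]; norm_num
  have hw : (256 : ℤ) ^ m = (1 + p * v) ^ 4 := by rw [← hu, ← pow_mul, mul_comm, pow_mul]; norm_num
  rw [hw]
  generalize ∏ i ∈ range m, (-(p : ℤ) + (i + 1)) = A at *
  generalize ∏ i ∈ range m, ((p : ℤ) + (i + 1)) = B at *
  generalize ∏ i ∈ range m, (-(p : ℤ) + 2 * (i + 1)) = C at *
  have key : (p : ℤ) ^ 2 ∣ b * p + 2 * m.factorial * p * v := by
    refine ⟨2 * c₁ + b * v - 2 ^ m * c₃, ?_⟩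
    linear_combination 2 * h₁ + 2 * h₀ - 2 ^ m * h₃ - (2 * m.factorial - b * p) * hu'
  obtain ⟨e, he⟩ := key
  refine ⟨c₁ - (1 + p * v) ^ 4 * c₂ - 2 * e - 4 * v * b -
    (6 * v ^ 2 + 4 * p * v ^ 3 + p ^ 2 * v ^ 4) * (m.factorial + b * p), ?_⟩
  linear_combination h₁ - (1 + p * v : ℤ) ^ 4 * h₂ - 2 * he

theorem sq_dvd_prod_sub_factorial (j : ℤ) (hp2 : p ≠ 2) :
    (p : ℤ) ^ 2 ∣ ∏ i ∈ range (p - 1), (j * p + (i + 1)) - (p - 1).factorial := by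
  obtain ⟨b, hb⟩ := exists_sq_dvd_prod_add (p - 1)
  obtain ⟨c₁, h₁⟩ := hb (-p) 1
  obtain ⟨c₂, h₂⟩ := hb (j * p) 1
  have h₀ : ∏ i ∈ range (p - 1), (-(p : ℤ) + (i + 1)) = (p - 1).factorial := by
    have h := prod_range_neg_one_mul (p - 1) (fun i ↦ ((i + 1 : ℕ) : ℤ))
    rw [(hp.even_sub_one hp2).neg_one_pow, one_mul] at h
    rw [← prod_range_add_one_eq_factorial, ← prod_range_reflect, Nat.cast_prod, ← h]
    refine prod_congr rfl fun i hi ↦ ?_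
    have := mem_range.mp hi
    push_cast [show p - 1 - 1 - i = p - (i + 2) by omega, Nat.cast_sub (show i + 2 ≤ p by omega)]
    ring
  simp only [one_mul, one_pow, h₀] at h₁ h₂
  exact ⟨j ^ 2 * c₂ + j * c₁, by linear_combination h₂ + j * h₁⟩

theorem sq_dvd_prod_mul_prod_sub {m : ℕ} (hm : p = 2 * m + 1) :
    (p : ℤ) ^ 2 ∣ (∏ i ∈ range (p - 1), ((p : ℤ) + (i + 1))) *
        ∏ i ∈ range (p - 1), (2 * (p : ℤ) + (i + 1)) -
      (-1) ^ m * (256 ^ m * (p - 1).factorial * m.factorial *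
        ∏ i ∈ range m, ((p : ℤ) + (i + 1))) := by
  obtain ⟨c₁, h₁⟩ := sq_dvd_prod_sub_factorial hp 1 (by omega)
  obtain ⟨c₂, h₂⟩ := sq_dvd_prod_sub_factorial hp 2 (by omega)
  obtain ⟨c₃, h₃⟩ := sq_dvd_prod_sub_prod hp hm
  have h₄ := factorial_two_mul_eq m
  rw [show 2 * m = p - 1 by omega, show (2 * m + 1 : ℤ) = p by rw [hm]; push_cast; ring] at h₄
  rw [one_mul] at h₁
  refine ⟨c₁ * ∏ i ∈ range (p - 1), (2 * (p : ℤ) + (i + 1)) + (p - 1).factorial * c₂ +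
    (-1) ^ m * m.factorial * (p - 1).factorial * c₃, ?_⟩
  linear_combination (∏ i ∈ range (p - 1), (2 * (p : ℤ) + (i + 1))) * h₁ +
    (p - 1).factorial * h₂ + (-1 : ℤ) ^ m * m.factorial * (p - 1).factorial * h₃ +
    (p - 1).factorial * h₄

end Congruences

section Valuation

variable {p : ℕ} [hp : Fact p.Prime]

theorem norm_factorial {n q : ℕ} (hqp : q < p) (h₁ : q * p ≤ n) (h₂ : n < (q + 1) * p) :
    ‖(n.factorial : ℚ_[p])‖ = (p : ℝ)⁻¹ ^ q := by
  have hn : n < p ^ 2 := by nlinarith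
  have hlog : Nat.log p n < 2 := by
    rcases eq_or_ne n 0 with rfl | h0
    · simp
    · exact (Nat.log_lt_iff_lt_pow hp.out.one_lt h0).mpr hn
  rw [Padic.norm_eq_zpow_neg_valuation (by exact_mod_cast n.factorial_ne_zero),
    Padic.valuation_natCast, padicValNat_factorial hlog]
  simp [Nat.div_eq_of_lt_le h₁ h₂]

theorem norm_factorial_eq_one {n : ℕ} (h : n < p) : ‖(n.factorial : ℚ_[p])‖ = 1 := by
  rw [norm_factorial (q := 0) hp.out.pos (by simp) (by simpa), pow_zero]

theorem norm_two_pow_eq_one (hp2 : p ≠ 2) (n : ℕ) : ‖((2 ^ n : ℕ) : ℚ_[p])‖ = 1 :=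
  Padic.norm_natCast_eq_one_iff.mpr
    (((Nat.coprime_primes hp.out Nat.prime_two).mpr hp2).pow_right n)

theorem norm_wzTerm {n k : ℕ} (hk : 2 * k < p) (hp2 : p ≠ 2) :
    ‖wzTerm ℚ_[p] n k‖ =
      ‖((4 * n + 2 * k).factorial : ℚ_[p])‖ * ‖((2 * n).factorial : ℚ_[p])‖ *
        ‖(n.descFactorial k : ℚ_[p])‖ /
        (‖((2 * n + k).factorial : ℚ_[p])‖ * ‖(n.factorial : ℚ_[p])‖ ^ 4) := by
  have h4 : ‖(4 : ℚ_[p])‖ = 1 := by simpa using norm_two_pow_eq_one hp2 2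
  have h1024 : ‖(1024 : ℚ_[p])‖ = 1 := by simpa using norm_two_pow_eq_one hp2 10
  have h₁ := norm_factorial_eq_one (p := p) (n := k) (by omega)
  have h₂ := norm_factorial_eq_one hk
  simp [wzTerm, h₁, h₂, h4, h1024]

theorem norm_boundary_term_le (hp3 : 3 < p) {k : ℕ} (hk : 2 * (k + 1) < p) :
    ‖64 * (p : ℚ_[p]) ^ 2 * wzTerm ℚ_[p] p (k + 1) / (4 * p + 2 * k + 1)‖ ≤ (p : ℝ)⁻¹ ^ 3 := by
  have hp0 : (0 : ℝ) < (p : ℝ)⁻¹ := inv_pos.mpr (by exact_mod_cast hp.out.pos)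
  have hp4 : 4 < p := by
    obtain ⟨m, hm⟩ := hp.out.odd_of_ne_two (by omega)
    omega
  have h64 : ‖(64 : ℚ_[p])‖ = 1 := by simpa using norm_two_pow_eq_one (p := p) (by omega) 6
  have hden : ‖(4 * p + 2 * k + 1 : ℚ_[p])‖ = 1 := by
    have : p.Coprime (4 * p + 2 * k + 1) := by
      rw [show 4 * p + 2 * k + 1 = 2 * k + 1 + p * 4 by ring, Nat.coprime_add_mul_left_right]
      exact Nat.coprime_of_lt_prime (by omega) (by omega) hp.out
    exact_mod_cast Padic.norm_natCast_eq_one_iff.mpr this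
  have hdesc : ‖(p.descFactorial (k + 1) : ℚ_[p])‖ ≤ (p : ℝ)⁻¹ := by
    obtain ⟨q, hq⟩ := Nat.exists_eq_succ_of_ne_zero hp.out.ne_zero
    have : p.descFactorial (k + 1) = p * q.descFactorial k := by
      conv_lhs => rw [hq, Nat.succ_eq_add_one, Nat.succ_descFactorial_succ]
      rw [hq]
    rw [this, Nat.cast_mul, norm_mul, Padic.norm_p]
    exact mul_le_of_le_one_right hp0.le (mod_cast Padic.norm_int_le_one (p := p) _)
  rw [norm_div, norm_mul, norm_mul, norm_pow, h64, hden, Padic.norm_p, norm_wzTerm hk (by omega),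
    norm_factorial (q := 4) hp4 (by omega) (by omega),
    norm_factorial (q := 2) (n := 2 * p) (by omega) (by omega) (by omega),
    norm_factorial (q := 2) (n := 2 * p + (k + 1)) (by omega) (by omega) (by omega),
    norm_factorial (q := 1) (n := p) (by omega) (by omega) (by omega)]
  generalize (p : ℝ)⁻¹ = ε at *
  generalize ‖(p.descFactorial (k + 1) : ℚ_[p])‖ = d at *
  calc _ = ε ^ 2 * d := by field_simp
    _ ≤ ε ^ 2 * ε := by gcongr
    _ = ε ^ 3 := by ring

theorem norm_wzTerm_le (hp3 : 3 < p) {m n : ℕ} (hm : p = 2 * m + 1) (hmn : m < n) (hn : n < p) :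
    ‖wzTerm ℚ_[p] n m‖ ≤ (p : ℝ)⁻¹ ^ 3 := by
  have hp0 : (0 : ℝ) < (p : ℝ)⁻¹ := inv_pos.mpr (by exact_mod_cast hp.out.pos)
  have hle {N q : ℕ} (hq : q < p) (hqN : q * p ≤ N) :
      ‖(N.factorial : ℚ_[p])‖ ≤ (p : ℝ)⁻¹ ^ q := by
    rw [← norm_factorial (n := q * p) hq le_rfl (by have := hp.out.pos; nlinarith)]
    obtain ⟨c, hc⟩ := Nat.factorial_dvd_factorial hqN
    rw [hc, Nat.cast_mul, norm_mul]
    exact mul_le_of_le_one_right (norm_nonneg _) (mod_cast Padic.norm_int_le_one (p := p) _)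
  have h₁ := hle (N := 2 * n) (q := 1) (by omega) (by omega)
  have h₂ : ‖(n.descFactorial m : ℚ_[p])‖ ≤ 1 := mod_cast Padic.norm_int_le_one (p := p) _
  rw [norm_wzTerm (by omega) (by omega), norm_factorial_eq_one hn, one_pow, mul_one]
  rcases lt_or_ge (2 * n + m) (2 * p) with h | h
  · have h₃ := hle (N := 4 * n + 2 * m) (q := 3) hp3 (by omega)
    rw [norm_factorial (q := 1) (n := 2 * n + m) (by omega) (by omega) (by omega),
      div_le_iff₀ (by positivity)]
    calc _ ≤ (p : ℝ)⁻¹ ^ 3 * (p : ℝ)⁻¹ ^ 1 * 1 := by gcongr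
      _ = _ := by ring
  · have hp4 : 4 < p := by omega
    have h₃ := hle (N := 4 * n + 2 * m) (q := 4) hp4 (by omega)
    rw [norm_factorial (q := 2) (n := 2 * n + m) (by omega) (by omega) (by omega),
      div_le_iff₀ (by positivity)]
    calc _ ≤ (p : ℝ)⁻¹ ^ 4 * (p : ℝ)⁻¹ ^ 1 * 1 := by gcongr
      _ = _ := by ring

theorem mul_wzTerm_self {m : ℕ} (hm : p = 2 * m + 1) :
    (20 * m - 2 * m + 3 : ℚ_[p]) * wzTerm ℚ_[p] m m *
        (256 ^ m * (p - 1).factorial * m.factorial * ∏ i ∈ range m, ((p : ℚ_[p]) + (i + 1))) =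
      3 * p * ((∏ i ∈ range (p - 1), ((p : ℚ_[p]) + (i + 1))) *
        ∏ i ∈ range (p - 1), (2 * (p : ℚ_[p]) + (i + 1))) := by
  have hfac (a k : ℕ) : (a.factorial : ℚ_[p]) * ∏ i ∈ range k, ((a : ℚ_[p]) + (i + 1)) =
      (a + k).factorial := by
    rw [← Nat.factorial_mul_ascFactorial, Nat.ascFactorial_eq_prod_range]
    push_cast
    exact congrArg _ (prod_congr rfl fun i _ ↦ by ring)
  have hC := hfac p m
  have hA := hfac p (p - 1)
  have hB := hfac (2 * p) (p - 1)
  have hm1 : p - 1 = 2 * m := by omega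
  have hpm : (p : ℚ_[p]) = 2 * m + 1 := by exact_mod_cast hm
  have e₁ : ((p).factorial : ℚ_[p]) = p * (2 * m).factorial := by
    rw [← hm1, ← Nat.cast_mul, Nat.mul_factorial_pred hp.out.ne_zero]
  have e₂ : ((2 * p).factorial : ℚ_[p]) = 2 * p * (p + (p - 1)).factorial := by
    rw [show 2 * p = p + (p - 1) + 1 by omega, Nat.factorial_succ,
      show p + (p - 1) + 1 = 2 * p by omega]
    push_cast; ring
  have e₃ : ((2 * p + (p - 1)).factorial : ℚ_[p]) =
      2 * (3 * m + 1) * (6 * m + 1) * (6 * m).factorial := by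
    rw [show 2 * p + (p - 1) = 6 * m + 1 + 1 by omega, Nat.factorial_succ, Nat.factorial_succ]
    push_cast; ring
  have e₄ : ((p + m).factorial : ℚ_[p]) = (3 * m + 1) * (3 * m).factorial := by
    rw [show p + m = 3 * m + 1 by omega, Nat.factorial_succ]
    push_cast; ring
  have n₁ : ((2 * m).factorial : ℚ_[p]) ≠ 0 := by exact_mod_cast Nat.factorial_ne_zero _
  have n₂ : (m.factorial : ℚ_[p]) ≠ 0 := by exact_mod_cast Nat.factorial_ne_zero _
  have n₃ : ((3 * m).factorial : ℚ_[p]) ≠ 0 := by exact_mod_cast Nat.factorial_ne_zero _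
  have n₄ : (3 * m + 1 : ℚ_[p]) ≠ 0 := by exact_mod_cast Nat.succ_ne_zero (3 * m)
  have n₅ : (p : ℚ_[p]) ≠ 0 := by exact_mod_cast hp.out.ne_zero
  rw [e₂, ← hA, e₁, e₃] at hB
  push_cast at hB
  rw [e₁, e₄] at hC
  have hwz : wzTerm ℚ_[p] m m * (256 ^ m * (2 * m).factorial * m.factorial * (3 * m).factorial) =
      (6 * m).factorial := by
    rw [wzTerm, Nat.descFactorial_self, show 4 * m + 2 * m = 6 * m by ring,
      show 2 * m + m = 3 * m by ring, ← two_mul, pow_mul (-1 : ℚ_[p]), neg_one_sq, one_pow,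
      show (1024 : ℚ_[p]) = 4 * 256 by norm_num, mul_pow]
    field_simp
  rw [hm1] at *
  generalize ∏ i ∈ range (2 * m), ((p : ℚ_[p]) + (i + 1)) = A at *
  generalize ∏ i ∈ range (2 * m), (2 * (p : ℚ_[p]) + (i + 1)) = B at *
  generalize ∏ i ∈ range m, ((p : ℚ_[p]) + (i + 1)) = C at *
  refine mul_left_cancel₀ (mul_ne_zero (mul_ne_zero two_ne_zero n₅) n₁) ?_
  linear_combination (2 * (18 * m + 3) * 256 ^ m * (2 * m).factorial * m.factorial *
    wzTerm ℚ_[p] m m) * hC + 2 * (18 * m + 3) * (3 * m + 1) * hwz - 3 * hB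

theorem norm_main_term_sub_le {m : ℕ} (hp2 : p ≠ 2) (hm : p = 2 * m + 1) :
    ‖(20 * m - 2 * m + 3 : ℚ_[p]) * wzTerm ℚ_[p] m m - 3 * ((-1) ^ m * p)‖ ≤ (p : ℝ)⁻¹ ^ 3 := by
  set D : ℚ_[p] := 256 ^ m * (p - 1).factorial * m.factorial *
    ∏ i ∈ range m, ((p : ℚ_[p]) + (i + 1)) with hD
  have hC : ‖∏ i ∈ range m, ((p : ℚ_[p]) + (i + 1))‖ = 1 := by
    rw [norm_prod]
    refine prod_eq_one fun i hi ↦ ?_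
    have := mem_range.mp hi
    have : p.Coprime (p + (i + 1)) := by
      rw [Nat.coprime_self_add_right]
      exact Nat.coprime_of_lt_prime (by omega) (by omega) hp.out
    exact_mod_cast Padic.norm_natCast_eq_one_iff.mpr this
  have h256 : ‖(256 : ℚ_[p])‖ = 1 := by simpa using norm_two_pow_eq_one hp2 8
  have hDn : ‖D‖ = 1 := by
    rw [hD, norm_mul, norm_mul, norm_mul, norm_pow, h256, hC, norm_factorial_eq_one (by omega),
      norm_factorial_eq_one (by omega)]
    simp
  obtain ⟨c, hc⟩ := sq_dvd_prod_mul_prod_sub hp.out hm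
  have hc' := congrArg (Int.cast : ℤ → ℚ_[p]) hc
  push_cast at hc'
  rw [← hD] at hc'
  have key : ((20 * m - 2 * m + 3 : ℚ_[p]) * wzTerm ℚ_[p] m m - 3 * ((-1) ^ m * p)) * D =
      p ^ 3 * ((3 * c : ℤ) : ℚ_[p]) := by
    have := mul_wzTerm_self hm
    rw [← hD] at this
    push_cast
    linear_combination this + 3 * p * hc'
  rw [← mul_one ‖_‖, ← hDn, ← norm_mul, key, norm_mul, norm_pow, Padic.norm_p]
  exact mul_le_of_le_one_right (by positivity) (Padic.norm_int_le_one _)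

theorem norm_sum_wzTerm_sub_le (hp3 : 3 < p) :
    ‖∑ n ∈ range p, (20 * n + 3) * wzTerm ℚ_[p] n 0 - 3 * ((-1) ^ ((p - 1) / 2) * p)‖ ≤
      (p : ℝ)⁻¹ ^ 3 := by
  obtain ⟨m, hm⟩ := hp.out.odd_of_ne_two (by omega)
  have hε : (0 : ℝ) ≤ (p : ℝ)⁻¹ ^ 3 := by positivity
  rw [show (p - 1) / 2 = m by omega, sum_wzTerm_zero p m,
    ← sum_erase_add _ _ (mem_range.mpr (show m < p by omega)), add_sub_right_comm, add_sub_assoc]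
  refine (Padic.nonarchimedean _ _).trans (max_le ((Padic.nonarchimedean _ _).trans
    (max_le ?_ (norm_main_term_sub_le (by omega) hm))) ?_)
  · refine IsUltrametricDist.norm_sum_le_of_forall_le_of_nonneg hε fun n hn ↦ ?_
    obtain ⟨hnm, hn⟩ := mem_erase.mp hn
    rcases lt_or_gt_of_ne hnm with h | h
    · simp [wzTerm, Nat.descFactorial_of_lt h]
    · have : ‖((20 * n - 2 * m + 3 : ℤ) : ℚ_[p])‖ ≤ 1 := Padic.norm_int_le_one _
      push_cast at this
      rw [norm_mul]
      exact (mul_le_of_le_one_left (norm_nonneg _) this).trans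
        (norm_wzTerm_le hp3 hm h (mem_range.mp hn))
  · refine IsUltrametricDist.norm_sum_le_of_forall_le_of_nonneg hε fun k hk ↦ ?_
    have := mem_range.mp hk
    exact norm_boundary_term_le hp3 (by omega)

end Valuation

theorem wzTerm_zero_right {K : Type*} [Field K] [CharZero K] (n : ℕ) :
    wzTerm K n 0 =
      (4 * n).choose n * (3 * n).choose n * (2 * n).choose n * (-(1024 : K)⁻¹) ^ n := by
  have n₁ (a : ℕ) : (a.factorial : K) ≠ 0 := by exact_mod_cast a.factorial_ne_zero
  rw [wzTerm, Nat.cast_choose K (show n ≤ 4 * n by omega),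
    Nat.cast_choose K (show n ≤ 3 * n by omega), Nat.cast_choose K (show n ≤ 2 * n by omega),
    show 4 * n - n = 3 * n by omega, show 3 * n - n = 2 * n by omega,
    show 2 * n - n = n by omega, neg_pow (1024 : K)⁻¹, inv_pow]
  have := n₁ n
  have := n₁ (2 * n)
  have := n₁ (3 * n)
  simp only [add_zero, mul_zero, Nat.factorial_zero, Nat.descFactorial_zero, pow_zero, Nat.cast_one]
  field_simp

theorem PadicInt.coe_inverse_natCast {p : ℕ} [Fact p.Prime] {n : ℕ} (h : p.Coprime n) :
    ((Ring.inverse (n : ℤ_[p]) : ℤ_[p]) : ℚ_[p]) = (n : ℚ_[p])⁻¹ := by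
  have hn : IsUnit (n : ℤ_[p]) := by
    rw [PadicInt.isUnit_iff, PadicInt.norm_def, PadicInt.coe_natCast]
    exact Padic.norm_natCast_eq_one_iff.mpr h
  refine eq_inv_of_mul_eq_one_left ?_
  rw [← PadicInt.coe_natCast, ← PadicInt.coe_mul, Ring.inverse_mul_cancel _ hn, PadicInt.coe_one]

/-- Zudilin: for a prime `p > 3` with `p ≡ 1, 3, 7, 9 mod 20`,
`∑_{k<p} (1 + (20/3)k) (4k)!/k!⁴ (-1/1024)^k ≡ (-1)^((p-1)/2) p mod p³`. -/
theorem stmt_12 (p : ℕ) [Fact p.Prime] (hp : 3 < p)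
    (hp20 : p % 20 = 1 ∨ p % 20 = 3 ∨ p % 20 = 7 ∨ p % 20 = 9) :
    (p : ℤ_[p]) ^ 3 ∣
      (∑ k ∈ Finset.range p,
          ((1 + 20 * Ring.inverse (3 : ℤ_[p]) * k) *
            (Nat.choose (4 * k) k * Nat.choose (3 * k) k * Nat.choose (2 * k) k : ℤ_[p]) *
            (-(Ring.inverse (1024 : ℤ_[p]))) ^ k))
        - (-1 : ℤ_[p]) ^ ((p - 1) / 2) * p := by
  have hp' : p.Prime := Fact.out
  have h3 : p.Coprime 3 := (Nat.coprime_primes hp' Nat.prime_three).mpr (by omega)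
  have h1024 : p.Coprime (2 ^ 10) :=
    ((Nat.coprime_primes hp' Nat.prime_two).mpr (by omega)).pow_right 10
  have i3 : ((Ring.inverse 3 : ℤ_[p]) : ℚ_[p]) = 3⁻¹ := by
    simpa using PadicInt.coe_inverse_natCast h3
  have i1024 : ((Ring.inverse 1024 : ℤ_[p]) : ℚ_[p]) = 1024⁻¹ := by
    simpa using PadicInt.coe_inverse_natCast h1024
  rw [← Ideal.mem_span_singleton, ← PadicInt.norm_le_pow_iff_mem_span_pow, PadicInt.norm_def]
  have n3 : ‖(3 : ℚ_[p])‖ = 1 := by exact_mod_cast Padic.norm_natCast_eq_one_iff.mpr h3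
  rw [zpow_neg, zpow_natCast, ← inv_pow]
  refine le_of_eq_of_le ?_ (norm_sum_wzTerm_sub_le hp)
  have norm_eq_of_three_mul {x y : ℚ_[p]} (h : 3 * x = y) : ‖x‖ = ‖y‖ := by
    rw [← h, norm_mul, n3, one_mul]
  refine norm_eq_of_three_mul ?_
  have c20 : ((20 : ℤ_[p]) : ℚ_[p]) = 20 := PadicInt.coe_natCast 20
  push_cast [PadicInt.coe_sum]
  rw [mul_sub, mul_sum, i3, i1024, c20]
  congr 1
  refine sum_congr rfl fun k _ ↦ ?_
  rw [wzTerm_zero_right]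
  field_simp
  ring
end

section
/- For every prime p > 3, \sum_{k=0}^{p-1} \binom{2k}{k} 3^{-k} \equiv \epsilon mod p^2 in Z_p, where \epsilon = \pm 1 is determined by p \equiv \epsilon mod 6. -/
open Finset

/-- The Lucas sequence `u (n + 2) = u (n + 1) - u n` with `u 0 = 0` and `u 1 = 1`. -/
def lucasOneOne : ℕ → ℤ
  | 0 => 0
  | 1 => 1
  | n + 2 => lucasOneOne (n + 1) - lucasOneOne n

lemma lucasOneOne_add_two (n : ℕ) :
    lucasOneOne (n + 2) = lucasOneOne (n + 1) - lucasOneOne n := by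
  rw [lucasOneOne]

lemma lucasOneOne_add_three (n : ℕ) : lucasOneOne (n + 3) = -lucasOneOne n := by
  rw [lucasOneOne_add_two, lucasOneOne_add_two]; ring

lemma lucasOneOne_add_three_mul (n r : ℕ) :
    lucasOneOne (r + 3 * n) = (-1) ^ n * lucasOneOne r := by
  induction n with
  | zero => simp
  | succ n ih =>
    rw [show r + 3 * (n + 1) = r + 3 * n + 3 by ring, lucasOneOne_add_three, ih]; ring

lemma sum_range_succ_choose_succ_mul (N M : ℕ) (f : ℕ → ℤ) :
    ∑ k ∈ range (M + 1), ((N + 1).choose k : ℤ) * f k =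
      ∑ k ∈ range (M + 1), (N.choose k : ℤ) * f k +
        ∑ k ∈ range M, (N.choose k : ℤ) * f (k + 1) := by
  rw [sum_range_succ' _ M, sum_range_succ' _ M]
  simp only [Nat.choose_succ_succ', Nat.cast_add, add_mul, sum_add_distrib, Nat.choose_zero_right]
  ring

lemma sum_choose_succ_mul_eq (n : ℕ) (f : ℕ → ℤ) :
    ∑ k ∈ range (n + 2), ((n + 1).choose k : ℤ) * f k =
      ∑ k ∈ range (n + 1), (n.choose k : ℤ) * (f k + f (k + 1)) := by
  rw [sum_range_succ_choose_succ_mul, sum_range_succ _ (n + 1)]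
  simp [mul_add, sum_add_distrib]

lemma sum_choose_mul_lucasOneOne (j a : ℕ) :
    ∑ k ∈ range (2 * j + 2), ((2 * j + 1).choose k : ℤ) * lucasOneOne (k + a) =
      3 ^ j * (lucasOneOne (j + a) + lucasOneOne (j + a + 1)) := by
  induction j generalizing a with
  | zero => simp [sum_range_succ, add_comm]
  | succ j ih =>
    have h (k : ℕ) : lucasOneOne (k + a) + lucasOneOne (k + 1 + a) +
        (lucasOneOne (k + 1 + a) + lucasOneOne (k + 1 + 1 + a)) =
          3 * lucasOneOne (k + (a + 1)) := by
      rw [show k + 1 + 1 + a = k + a + 2 by ring, lucasOneOne_add_two,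
        show k + 1 + a = k + a + 1 by ring, ← add_assoc k a 1]
      ring
    rw [show 2 * (j + 1) + 2 = 2 * j + 2 + 2 by ring,
      show 2 * (j + 1) + 1 = 2 * j + 2 + 1 by ring, sum_choose_succ_mul_eq,
      sum_choose_succ_mul_eq (2 * j + 1)]
    simp only [h, mul_left_comm _ (3 : ℤ), ← mul_sum]
    rw [ih, show j + 1 + a = j + (a + 1) by ring]
    ring

lemma sum_centralBinom_mul_three_pow (n : ℕ) :
    ∑ k ∈ range n, ((2 * k).choose k : ℤ) * 3 ^ (n - 1 - k) =
      ∑ k ∈ range (n + 1), ((2 * n).choose k : ℤ) * lucasOneOne (n - k) := by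
  induction n with
  | zero => simp [lucasOneOne]
  | succ n ih =>
    have hl : ∑ k ∈ range (n + 1), ((2 * k).choose k : ℤ) * 3 ^ (n + 1 - 1 - k) =
        3 * ∑ k ∈ range n, ((2 * k).choose k : ℤ) * 3 ^ (n - 1 - k) + (2 * n).choose n := by
      rw [sum_range_succ, mul_sum]
      congr 1
      · refine sum_congr rfl fun k hk => ?_
        rw [mem_range] at hk
        rw [show n + 1 - 1 - k = n - 1 - k + 1 by lia]
        ring
      · simp
    have hs : ∑ k ∈ range n, ((2 * n).choose k : ℤ) * lucasOneOne (n + 1 - k) +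
        2 * ∑ k ∈ range n, ((2 * n).choose k : ℤ) * lucasOneOne (n - k) +
        ∑ k ∈ range n, ((2 * n).choose k : ℤ) * lucasOneOne (n - (k + 1)) =
        3 * ∑ k ∈ range n, ((2 * n).choose k : ℤ) * lucasOneOne (n - k) := by
      simp only [mul_sum, ← sum_add_distrib]
      refine sum_congr rfl fun k hk => ?_
      rw [mem_range] at hk
      obtain ⟨d, rfl⟩ := Nat.exists_eq_add_of_lt hk
      rw [show k + d + 1 + 1 - k = d + 2 by lia, show k + d + 1 - k = d + 1 by lia,
        show k + d + 1 - (k + 1) = d by lia, lucasOneOne_add_two]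
      ring
    rw [hl, ih, show 2 * (n + 1) = 2 * n + 1 + 1 by ring, sum_range_succ_choose_succ_mul,
      sum_range_succ_choose_succ_mul (2 * n), sum_range_succ_choose_succ_mul (2 * n) n]
    simp only [Nat.add_sub_add_right]
    simp only [sum_range_succ _ (n + 1), sum_range_succ _ n, Nat.sub_self,
      show n + 1 - n = 1 by lia, show lucasOneOne 0 = 0 from rfl, show lucasOneOne 1 = 1 from rfl]
    linear_combination -hs

lemma Nat.Prime.sq_dvd_choose_two_mul_sub {p k : ℕ} (hp : p.Prime) (hk : 0 < k) (hkp : k < p) :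
    (p : ℤ) ^ 2 ∣ ((2 * p).choose k : ℤ) - 2 * (p.choose k : ℤ) := by
  obtain ⟨k, rfl⟩ := Nat.exists_eq_add_of_lt hk
  rw [zero_add] at hkp ⊢
  rw [two_mul, Nat.add_choose_eq, Finset.Nat.sum_antidiagonal_eq_sum_range_succ_mk,
    sum_range_succ, sum_range_succ']
  simp only [Nat.choose_zero_right, Nat.sub_self, Nat.sub_zero, one_mul, mul_one]
  push_cast
  rw [show ∀ s c : ℤ, s + c + c - 2 * c = s by intros; ring]
  refine dvd_sum fun i hi => ?_
  rw [mem_range] at hi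
  rw [sq]
  exact mul_dvd_mul (Int.natCast_dvd_natCast.2 <| hp.dvd_choose_self (by lia) (by lia))
    (Int.natCast_dvd_natCast.2 <| hp.dvd_choose_self (by lia) (by lia))

lemma sq_dvd_sum_choose_two_mul_sub {p : ℕ} (hp : p.Prime) (f : ℕ → ℤ) (hf : f 0 = 0) :
    (p : ℤ) ^ 2 ∣ ∑ k ∈ range (p + 1), ((2 * p).choose k : ℤ) * f (p - k) -
      (2 * ∑ k ∈ range (p + 1), (p.choose k : ℤ) * f k - f p) := by
  have hflip : ∑ k ∈ range (p + 1), (p.choose k : ℤ) * f k =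
      ∑ k ∈ range (p + 1), (p.choose k : ℤ) * f (p - k) := by
    rw [← sum_flip]
    refine sum_congr rfl fun k hk => ?_
    rw [Nat.choose_symm (by rw [mem_range] at hk; lia)]
  obtain ⟨q, rfl⟩ := Nat.exists_eq_add_of_lt hp.pos
  rw [zero_add] at *
  rw [hflip, sum_range_succ, sum_range_succ', sum_range_succ _ (q + 1), sum_range_succ' _ q]
  simp only [Nat.choose_zero_right, Nat.sub_self, hf, Nat.sub_zero, mul_zero, add_zero,
    Nat.cast_one, one_mul]
  rw [show ∀ s t c : ℤ, s + c - (2 * (t + c) - c) = s - 2 * t by intros; ring, mul_sum,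
    ← sum_sub_distrib]
  refine dvd_sum fun k hk => ?_
  rw [mem_range] at hk
  rw [← mul_assoc, ← sub_mul]
  exact (hp.sq_dvd_choose_two_mul_sub k.succ_pos (by lia)).mul_right _

lemma dvd_sum_choose_mul_sub {p : ℕ} (hp : p.Prime) (f : ℕ → ℤ) (hf : f 0 = 0) :
    (p : ℤ) ∣ ∑ k ∈ range (p + 1), (p.choose k : ℤ) * f k - f p := by
  rw [sum_range_succ, Nat.choose_self, Nat.cast_one, one_mul, add_sub_cancel_right]
  refine dvd_sum fun k hk => ?_
  rw [mem_range] at hk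
  rcases Nat.eq_zero_or_pos k with rfl | hk0
  · simp [hf]
  · exact (Int.natCast_dvd_natCast.2 <| hp.dvd_choose_self hk0.ne' hk).mul_right _

lemma sq_dvd_sum_centralBinom_mul_three_pow_sub {p : ℕ} (hp : p.Prime) (ε : ℤ)
    (hε : ε = 1 ∨ ε = -1) (hmod : (p : ℤ) ≡ ε [ZMOD 6]) :
    (p : ℤ) ^ 2 ∣
      ∑ k ∈ range p, ((2 * k).choose k : ℤ) * 3 ^ (p - 1 - k) - ε * 3 ^ (p - 1) := by
  obtain ⟨j, hj, hu, hw⟩ : ∃ j, p = 2 * j + 1 ∧ lucasOneOne p = ε ∧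
      (lucasOneOne (j + 0) + lucasOneOne (j + 0 + 1)) ^ 2 = 1 := by
    rcases hε with rfl | rfl
    · obtain ⟨n, rfl⟩ : ∃ n, p = 1 + 3 * (2 * n) := ⟨p / 6, by unfold Int.ModEq at hmod; lia⟩
      refine ⟨0 + 3 * n, by ring, ?_, ?_⟩
      · rw [lucasOneOne_add_three_mul]; simp [lucasOneOne]
      · rw [add_zero, lucasOneOne_add_three_mul, show 0 + 3 * n + 1 = 1 + 3 * n by ring,
          lucasOneOne_add_three_mul]
        simp [lucasOneOne, ← pow_mul']
    · obtain ⟨n, rfl⟩ : ∃ n, p = 5 + 3 * (2 * n) := ⟨p / 6, by unfold Int.ModEq at hmod; lia⟩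
      refine ⟨2 + 3 * n, by ring, ?_, ?_⟩
      · rw [lucasOneOne_add_three_mul]; simp [lucasOneOne]
      · rw [add_zero, lucasOneOne_add_three_mul, show 2 + 3 * n + 1 = 3 + 3 * n by ring,
          lucasOneOne_add_three_mul]
        simp [lucasOneOne, ← pow_mul']
  have hsq := sq_dvd_sum_choose_two_mul_sub hp lucasOneOne rfl
  have hlin := dvd_sum_choose_mul_sub hp lucasOneOne rfl
  rw [← sum_centralBinom_mul_three_pow] at hsq
  have hx : (∑ k ∈ range (p + 1), (p.choose k : ℤ) * lucasOneOne k) ^ 2 = 3 ^ (p - 1) := by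
    have := sum_choose_mul_lucasOneOne j 0
    rw [hj]
    simp only [add_zero] at this hw
    rw [this, mul_pow, hw, mul_one, ← pow_mul, Nat.add_sub_cancel, mul_comm]
  rw [hu] at hsq hlin
  have hε2 : ε ^ 2 = 1 := by rcases hε with rfl | rfl <;> norm_num
  rw [← hx]
  refine (dvd_sub hsq ((pow_dvd_pow_of_dvd hlin 2).mul_left ε)).trans (dvd_of_eq ?_)
  linear_combination (2 * ∑ k ∈ range (p + 1), (p.choose k : ℤ) * lucasOneOne k - ε) * hε2

/-- For any prime `p > 3` with `p ≡ ε mod 6`, `ε = ±1`,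
`∑_{k<p} binom(2k,k) 3^{-k} ≡ ε mod p²` in `ℤ_[p]`. -/
theorem stmt_17 (p : ℕ) [Fact p.Prime] (hp : 3 < p) (ε : ℤ) (hε : ε = 1 ∨ ε = -1)
    (hmod : (p : ℤ) ≡ ε [ZMOD 6]) :
    (p : ℤ_[p]) ^ 2 ∣
      (∑ k ∈ Finset.range p,
          ((Nat.choose (2 * k) k : ℤ_[p]) * (Ring.inverse (3 : ℤ_[p])) ^ k))
        - (ε : ℤ_[p]) := by
  have h3 : IsUnit (3 : ℤ_[p]) := by
    have h : IsUnit ((3 : ℕ) : ℤ_[p]) := by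
      rw [PadicInt.isUnit_iff, PadicInt.norm_natCast_eq_one_iff]
      exact Nat.coprime_of_lt_prime (by lia) hp Fact.out
    exact_mod_cast h
  have hdvd := map_dvd (Int.castRingHom ℤ_[p])
    (sq_dvd_sum_centralBinom_mul_three_pow_sub Fact.out ε hε hmod)
  rw [← (h3.pow (p - 1)).dvd_mul_left]
  convert hdvd using 1
  · simp
  · simp only [eq_intCast, Int.cast_sub, Int.cast_sum, Int.cast_mul, Int.cast_natCast,
      Int.cast_pow, Int.cast_ofNat]
    rw [mul_sub, mul_sum, mul_comm (ε : ℤ_[p])]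
    congr 1
    refine sum_congr rfl fun k hk => ?_
    rw [mem_range] at hk
    have hk' : p - 1 = p - 1 - k + k := by lia
    have hinv : (3 : ℤ_[p]) ^ k * Ring.inverse 3 ^ k = 1 := by
      rw [← mul_pow, Ring.mul_inverse_cancel _ h3, one_pow]
    conv_lhs => rw [hk', pow_add]
    linear_combination ((2 * k).choose k : ℤ_[p]) * 3 ^ (p - 1 - k) * hinv
end
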